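/- Let q = k/m ∈ [1,2) be rational in lowest terms, h > 0, t_j := jh, s_j := jh/q, and fix n ∈ ℕ. Let 𝒯 = {τ_ℓ}_{ℓ=1}^{k+m−1} be the ascending enumeration of all grid points of either grid lying in (nmh, (n+1)mh], i.e. the union of 𝒯_s := {s_{nk+j}}_{j=1}^{k−1} and 𝒯_t := {t_{nm+j}}_{j=1}^{m} (these two sets are disjoint), and set τ₀ := t_{nm}. Let Λ₁ := {τ_ℓ ∈ 𝒯_s : τ_{ℓ−1} ∈ 𝒯_s}, and for each ℓ let τ̂_ℓ := (τ_{ℓ−1} + τ_ℓ)/2. Let Y^h and Y^{h/q} be the splitting-scheme approximations with steps h and h/q started from the same initial datum, and set ΔY := Y^h − Y^{h/q}. Then there exists a constant C, depending on k + m and on d, T, α, γ, f, X, C_Z but not on h or n, such that |ΔY_{t_{(n+1)m}} − ΔY_{t_{nm}}| ≤ C ( h^{γα} + |ΔY_{t_{nm}}|^{γ−2} h^{2α} + Σ_{τ_ℓ ∈ 𝒯 \ Λ₁} |ΔY_{τ̂_ℓ}| h^α ). -/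

import Mathlib

open scoped Classical

noncomputable section

/-- The setting of the paper: a time horizon `T`, a Hölder exponent `α ∈ (1/3, 1/2]`,
a regularity parameter `γ` with `1/α < γ ≤ 3`, an `α`-Hölder driver `X` (with Hölder
constant `CX`), a coefficient `f ∈ C^{γ-1}_b` (bounded, with bounded derivative `Df`
which is globally `(γ-2)`-Hölder; all bounds collected in the constant `M`), and a
second-order datum `Z` vanishing on the diagonal and satisfying the analytic
conditions (1), (2) and the algebraic (Chen-type) condition (3) with constant `CZ`. -/
structure RoughSetting (d : ℕ) where
  T : ℝ
  α : ℝ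
  γ : ℝ
  CX : ℝ
  CZ : ℝ
  M : ℝ
  X : ℝ → EuclideanSpace ℝ (Fin d)
  f : EuclideanSpace ℝ (Fin d) → EuclideanSpace ℝ (Fin d) →L[ℝ] EuclideanSpace ℝ (Fin d)
  Df : EuclideanSpace ℝ (Fin d) →
    EuclideanSpace ℝ (Fin d) →L[ℝ] EuclideanSpace ℝ (Fin d) →L[ℝ] EuclideanSpace ℝ (Fin d)
  Z : EuclideanSpace ℝ (Fin d) → ℝ → ℝ → EuclideanSpace ℝ (Fin d)
  hd : 0 < d
  hT : 0 < T
  hα₁ : 1 / 3 < α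
  hα₂ : α ≤ 1 / 2
  hγ₁ : 1 / α < γ
  hγ₂ : γ ≤ 3
  hf_bdd : ∀ x, ‖f x‖ ≤ M
  hf_deriv : ∀ x, HasFDerivAt f (Df x) x
  hDf_bdd : ∀ x, ‖Df x‖ ≤ M
  hDf_holder : ∀ x y, ‖Df x - Df y‖ ≤ M * ‖x - y‖ ^ (γ - 2)
  hX : ∀ s t : ℝ, ‖X t - X s‖ ≤ CX * |t - s| ^ α
  hZ_diag : ∀ x t, Z x t t = 0
  hZ1 : ∀ x, ∀ s t : ℝ, s ≤ t → ‖Z x s t‖ ≤ CZ * (t - s) ^ (2 * α)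
  hZ2 : ∀ x y, ∀ s t : ℝ, s ≤ t →
    ‖Z x s t - Z y s t‖ ≤ CZ * ‖x - y‖ ^ (γ - 2) * (t - s) ^ (2 * α)
  hZ3 : ∀ x, ∀ s u t : ℝ, s ≤ u → u ≤ t →
    ‖Z x s t - Z x s u - Z x u t -
        (Df x (f x (X u - X s)) (X t - X u) + Df x (Z x s u) (X t - X u))‖ ≤
      CZ * (t - s) ^ (3 * α)

/-- `Y` is the splitting-scheme approximation with step size `h` and initial datum
`Ybar`: on the grid `t_j = j h`, the first split equation (driven by `X`) is run at
twice the speed on `(t_j, t_j + h/2]`, and the second split equation (driven by `Z`)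
is run at twice the speed on `(t_j + h/2, t_{j+1}]`. -/
def RoughSetting.IsScheme {d : ℕ} (S : RoughSetting d) (h : ℝ)
    (Ybar : EuclideanSpace ℝ (Fin d)) (Y : ℝ → EuclideanSpace ℝ (Fin d)) : Prop :=
  Y 0 = Ybar ∧
    ∀ j : ℕ, ∀ t : ℝ,
      (t ∈ Set.Ioc ((j : ℝ) * h) ((j : ℝ) * h + h / 2) →
        Y t = Y ((j : ℝ) * h) +
          S.f (Y ((j : ℝ) * h))
            (S.X ((j : ℝ) * h + 2 * (t - (j : ℝ) * h)) - S.X ((j : ℝ) * h))) ∧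
      (t ∈ Set.Ioc ((j : ℝ) * h + h / 2) ((j : ℝ) * h + h) →
        Y t = Y ((j : ℝ) * h + h / 2) +
          S.Z (Y ((j : ℝ) * h + h / 2)) ((j : ℝ) * h)
            ((j : ℝ) * h + 2 * (t - ((j : ℝ) * h + h / 2))))

/-- The part of the fine grid `s_j = j · (h/q)` lying strictly between `nmh` and
`(n+1)mh` (endpoint removed): `𝒯_s = {s_{nk+j} : 1 ≤ j ≤ k−1}`, where `q = k/m`
in lowest terms and `hq = h/q = h·m/k`. -/
def gridTs (k n : ℕ) (hq : ℝ) : Finset ℝ :=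
  (Finset.Icc 1 (k - 1)).image fun j => ((n * k + j : ℕ) : ℝ) * hq

/-- The part of the coarse grid `t_j = j·h` lying in `(nmh, (n+1)mh]`:
`𝒯_t = {t_{nm+j} : 1 ≤ j ≤ m}`. -/
def gridTt (m n : ℕ) (h : ℝ) : Finset ℝ :=
  (Finset.Icc 1 m).image fun j => ((n * m + j : ℕ) : ℝ) * h

namespace RoughSetting

variable {d : ℕ} (S : RoughSetting d)

lemma two_lt_gamma : 2 < S.γ := by
  have hα : 0 < S.α := by linarith [S.hα₁]
  have : 2 ≤ 1 / S.α := by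
    rw [le_div_iff₀ hα]
    linarith [S.hα₂]
  linarith [S.hγ₁]

/-- A common upper bound `K ≥ 1` for the constants `M`, `CX`, `CZ` of the setting. -/
structure IsBound (K : ℝ) : Prop where
  one_le : 1 ≤ K
  M_le : S.M ≤ K
  CX_le : S.CX ≤ K
  CZ_le : S.CZ ≤ K

lemma exists_isBound : ∃ K, S.IsBound K :=
  ⟨max 1 (max S.M (max S.CX S.CZ)), by simp, by simp, by simp, by simp⟩

variable {S} {K h H : ℝ}

lemma IsBound.norm_f_le (hK : S.IsBound K) (x : EuclideanSpace ℝ (Fin d)) : ‖S.f x‖ ≤ K :=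
  (S.hf_bdd x).trans hK.M_le

lemma IsBound.norm_Df_le (hK : S.IsBound K) (x : EuclideanSpace ℝ (Fin d)) : ‖S.Df x‖ ≤ K :=
  (S.hDf_bdd x).trans hK.M_le

lemma IsBound.norm_Df_sub_le (hK : S.IsBound K) (x y : EuclideanSpace ℝ (Fin d)) :
    ‖S.Df x - S.Df y‖ ≤ K * ‖x - y‖ ^ (S.γ - 2) :=
  (S.hDf_holder x y).trans (by have := hK.M_le; gcongr)

lemma IsBound.norm_f_sub_le (hK : S.IsBound K) (x y : EuclideanSpace ℝ (Fin d)) :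
    ‖S.f x - S.f y‖ ≤ K * ‖x - y‖ :=
  convex_univ.norm_image_sub_le_of_norm_hasFDerivWithin_le
    (fun z _ => (S.hf_deriv z).hasFDerivWithinAt) (fun z _ => hK.norm_Df_le z)
    (Set.mem_univ y) (Set.mem_univ x)

lemma IsBound.norm_taylor_le (hK : S.IsBound K) (x y : EuclideanSpace ℝ (Fin d)) :
    ‖S.f x - S.f y - S.Df y (x - y)‖ ≤ K * ‖x - y‖ ^ (S.γ - 2) * ‖x - y‖ := by
  refine (convex_segment y x).norm_image_sub_le_of_norm_hasFDerivWithin_le'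
    (fun z _ => (S.hf_deriv z).hasFDerivWithinAt) (fun z hz => ?_)
    (left_mem_segment ℝ y x) (right_mem_segment ℝ y x)
  refine (hK.norm_Df_sub_le z y).trans ?_
  have h1 : ‖z - y‖ ≤ ‖x - y‖ := by
    simpa [dist_eq_norm] using
      norm_sub_le_of_mem_segment hz
  have := hK.one_le
  have := S.two_lt_gamma
  gcongr

lemma IsBound.norm_X_sub_le (hK : S.IsBound K) (hH : h ^ S.α ≤ H) {s t : ℝ}
    (hst : s ≤ t) (hh : t - s ≤ h) : ‖S.X t - S.X s‖ ≤ K * H := by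
  refine (S.hX s t).trans ?_
  have hα : 0 < S.α := by linarith [S.hα₁]
  rw [abs_of_nonneg (by linarith)]
  have h1 : (t - s) ^ S.α ≤ H :=
    (Real.rpow_le_rpow (by linarith) hh hα.le).trans hH
  have h0 : 0 ≤ (t - s) ^ S.α := Real.rpow_nonneg (by linarith) _
  have := hK.one_le
  exact mul_le_mul hK.CX_le h1 h0 (by linarith)

lemma rpow_natCast_mul_le (hH : h ^ S.α ≤ H) {x : ℝ} (hx : 0 ≤ x) (hh : x ≤ h) (c : ℕ) :
    x ^ ((c : ℝ) * S.α) ≤ H ^ c := by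
  have hα : 0 < S.α := by linarith [S.hα₁]
  rw [mul_comm, Real.rpow_mul hx, Real.rpow_natCast]
  have h0 : 0 ≤ x ^ S.α := Real.rpow_nonneg hx _
  exact pow_le_pow_left₀ h0 ((Real.rpow_le_rpow hx hh hα.le).trans hH) c

lemma IsBound.norm_Z_le (hK : S.IsBound K) (hH : h ^ S.α ≤ H)
    (x : EuclideanSpace ℝ (Fin d)) {s t : ℝ}
    (hst : s ≤ t) (hh : t - s ≤ h) : ‖S.Z x s t‖ ≤ K * H ^ 2 := by
  have h1 := rpow_natCast_mul_le hH (sub_nonneg.2 hst) hh 2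
  have h0 : 0 ≤ (t - s) ^ (2 * S.α) := Real.rpow_nonneg (by linarith) _
  have := hK.one_le
  push_cast at h1
  exact (S.hZ1 x s t hst).trans (mul_le_mul hK.CZ_le h1 h0 (by linarith))

lemma IsBound.norm_Z_sub_le (hK : S.IsBound K) (hH : h ^ S.α ≤ H)
    (x y : EuclideanSpace ℝ (Fin d)) {s t : ℝ}
    (hst : s ≤ t) (hh : t - s ≤ h) :
    ‖S.Z x s t - S.Z y s t‖ ≤ K * ‖x - y‖ ^ (S.γ - 2) * H ^ 2 := by
  have h1 := rpow_natCast_mul_le hH (sub_nonneg.2 hst) hh 2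
  have h0 : 0 ≤ (t - s) ^ (2 * S.α) := Real.rpow_nonneg (by linarith) _
  have := hK.one_le
  push_cast at h1
  refine (S.hZ2 x y s t hst).trans (mul_le_mul ?_ h1 h0 (by positivity))
  have := hK.CZ_le
  gcongr

lemma IsBound.norm_chen_le (hK : S.IsBound K) (hH : h ^ S.α ≤ H)
    (x : EuclideanSpace ℝ (Fin d)) {s u t : ℝ}
    (hsu : s ≤ u) (hut : u ≤ t) (hh : t - s ≤ h) :
    ‖S.Z x s t - S.Z x s u - S.Z x u t -
        (S.Df x (S.f x (S.X u - S.X s)) (S.X t - S.X u) +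
          S.Df x (S.Z x s u) (S.X t - S.X u))‖ ≤ K * H ^ 3 := by
  have h1 := rpow_natCast_mul_le hH (sub_nonneg.2 (hsu.trans hut)) hh 3
  have h0 : 0 ≤ (t - s) ^ (3 * S.α) := Real.rpow_nonneg (by linarith) _
  have := hK.one_le
  push_cast at h1
  exact (S.hZ3 x s u t hsu hut).trans (mul_le_mul hK.CZ_le h1 h0 (by linarith))

lemma IsBound.norm_f_apply_le (hK : S.IsBound K) (x : EuclideanSpace ℝ (Fin d))
    {w : EuclideanSpace ℝ (Fin d)} {b : ℝ} (hw : ‖w‖ ≤ b) :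
    ‖S.f x w‖ ≤ K * b :=
  ((S.f x).le_of_opNorm_le (hK.norm_f_le x) w).trans
    (mul_le_mul_of_nonneg_left hw (by linarith [hK.one_le]))

/-- The Hölder exponent `γ - 2 ∈ (0, 1]` acting on a quantity of order `H`. -/
lemma rpow_gamma_sub_two_le {x b : ℝ} (hx : 0 ≤ x) (hb : 1 ≤ b) (hH : 0 < H)
    (hxb : x ≤ b * H) : x ^ (S.γ - 2) ≤ b * H ^ (S.γ - 2) := by
  have h2 := S.two_lt_gamma
  have h3 := S.hγ₂
  refine (Real.rpow_le_rpow hx hxb (by linarith)).trans ?_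
  rw [Real.mul_rpow (by linarith) hH.le]
  have : b ^ (S.γ - 2) ≤ b := by
    simpa using Real.rpow_le_rpow_of_exponent_le hb (by linarith : S.γ - 2 ≤ 1)
  gcongr

lemma rpow_gamma_eq (S : RoughSetting d) (hH : 0 < H) :
    H ^ S.γ = H ^ (S.γ - 2) * H ^ 2 := by
  rw [← Real.rpow_natCast, ← Real.rpow_add hH]
  norm_num

lemma cube_le_rpow_gamma (S : RoughSetting d) (hH : 0 < H) (hH1 : H ≤ 1) :
    H ^ 3 ≤ H ^ S.γ := by
  rw [← Real.rpow_natCast]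
  exact Real.rpow_le_rpow_of_exponent_ge hH hH1 (by simpa using S.hγ₂)

/-- Local consistency: the one-step splitting interpolant started from `y` at time `p` satisfies
the Davie-type expansion between any two times `u ≤ v` of the cell. -/
lemma IsBound.norm_local_expansion_le (hK : S.IsBound K) (hH : h ^ S.α ≤ H) (hH0 : 0 < H)
    (hH1 : H ≤ 1) (y y' : EuclideanSpace ℝ (Fin d)) {p u v : ℝ} (hpu : p ≤ u) (huv : u ≤ v)
    (hh : v - p ≤ h)
    (hy' : ‖y' - y‖ ≤ K ^ 2 * H) (A : EuclideanSpace ℝ (Fin d))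
    (hA : A = y + S.f y (S.X u - S.X p) + S.Z y' p u) :
    ‖S.f y (S.X v - S.X u) + S.Z y' p v - S.Z y' p u -
        (S.f A (S.X v - S.X u) + S.Z A u v)‖ ≤ 14 * K ^ 6 * H ^ S.γ := by
  have hK1 := hK.one_le
  have hK0 : 0 ≤ K := by linarith
  have hXpu := hK.norm_X_sub_le hH hpu (by linarith)
  have hXuv := hK.norm_X_sub_le hH huv (by linarith)
  have hZpu := hK.norm_Z_le hH y' hpu (by linarith)
  have hAy : ‖A - y‖ ≤ 2 * K ^ 2 * H := by
    have e : A - y = S.f y (S.X u - S.X p) + S.Z y' p u := by rw [hA]; abel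
    rw [e]
    refine (norm_add_le_of_le (hK.norm_f_apply_le y hXpu) hZpu).trans ?_
    nlinarith [mul_nonneg hK0 hH0.le, mul_nonneg (mul_nonneg hK0 hH0.le) (sub_nonneg.2 hK1),
      mul_nonneg (mul_nonneg hK0 hH0.le) (sub_nonneg.2 hH1)]
  have hAy' : ‖y' - A‖ ≤ 3 * K ^ 2 * H := by
    have e : y' - A = (y' - y) - (A - y) := by abel
    rw [e]
    exact (norm_sub_le_of_le hy' hAy).trans (by linarith)
  set δ := S.γ - 2 with hδ
  have hKK : 1 ≤ K ^ 2 := one_le_pow₀ hK1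
  have r1 := rpow_gamma_sub_two_le (S := S) (norm_nonneg _) hKK hH0 hy'
  have r2 := rpow_gamma_sub_two_le (S := S) (norm_nonneg _) (by linarith) hH0 hAy
  have r3 := rpow_gamma_sub_two_le (S := S) (norm_nonneg _) (by linarith) hH0 hAy'
  have hg := S.rpow_gamma_eq hH0
  have hc := S.cube_le_rpow_gamma hH0 hH1
  set G := H ^ S.γ
  set L := H ^ δ
  have hL0 : 0 ≤ L := Real.rpow_nonneg hH0.le _
  have hG0 : 0 ≤ G := Real.rpow_nonneg hH0.le _
  have e1 := hK.norm_chen_le hH y' hpu huv hh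
  have e2 : ‖S.Z y' u v - S.Z A u v‖ ≤ 3 * K ^ 3 * G := by
    refine (hK.norm_Z_sub_le hH y' A huv (by linarith)).trans ?_
    calc _ ≤ K * (3 * K ^ 2 * L) * H ^ 2 := by gcongr
      _ = 3 * K ^ 3 * G := by rw [hg]; ring
  have e3 : ‖(S.f A - S.f y - S.Df y (A - y)) (S.X v - S.X u)‖ ≤ 4 * K ^ 6 * G := by
    calc _ ≤ (K * (2 * K ^ 2 * L) * (2 * K ^ 2 * H)) * (K * H) := by
          refine ContinuousLinearMap.le_of_opNorm_le_of_le _ ?_ hXuv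
          refine (hK.norm_taylor_le A y).trans ?_
          gcongr
      _ = 4 * K ^ 6 * G := by rw [hg]; ring
  have e4 : ‖(S.Df y' - S.Df y) (S.f y' (S.X u - S.X p) + S.Z y' p u) (S.X v - S.X u)‖ ≤
      2 * K ^ 6 * G := by
    have hw : ‖S.f y' (S.X u - S.X p) + S.Z y' p u‖ ≤ 2 * K ^ 2 * H := by
      refine (norm_add_le_of_le (hK.norm_f_apply_le y' hXpu) hZpu).trans ?_
      nlinarith [mul_nonneg hK0 hH0.le, mul_nonneg (mul_nonneg hK0 hH0.le) (sub_nonneg.2 hK1),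
        mul_nonneg (mul_nonneg hK0 hH0.le) (sub_nonneg.2 hH1)]
    calc _ ≤ (K * (K ^ 2 * L) * (2 * K ^ 2 * H)) * (K * H) := by
          refine ContinuousLinearMap.le_of_opNorm_le_of_le _ ?_ hXuv
          refine ContinuousLinearMap.le_of_opNorm_le_of_le _ ?_ hw
          refine (hK.norm_Df_sub_le y' y).trans ?_
          gcongr
      _ = 2 * K ^ 6 * G := by rw [hg]; ring
  have e5 : ‖S.Df y ((S.f y' - S.f y) (S.X u - S.X p)) (S.X v - S.X u)‖ ≤ K ^ 6 * G := by
    calc _ ≤ (K * ((K * (K ^ 2 * H)) * (K * H))) * (K * H) := by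
          refine ContinuousLinearMap.le_of_opNorm_le_of_le _ ?_ hXuv
          refine ContinuousLinearMap.le_of_opNorm_le_of_le _ (hK.norm_Df_le y) ?_
          refine ContinuousLinearMap.le_of_opNorm_le_of_le _ ?_ hXpu
          exact (hK.norm_f_sub_le y' y).trans (by gcongr)
      _ = K ^ 6 * H ^ 3 := by ring
      _ ≤ K ^ 6 * G := by gcongr
  have key : S.f y (S.X v - S.X u) + S.Z y' p v - S.Z y' p u -
        (S.f A (S.X v - S.X u) + S.Z A u v) =
      (S.Z y' p v - S.Z y' p u - S.Z y' u v -
        (S.Df y' (S.f y' (S.X u - S.X p)) (S.X v - S.X u) +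
          S.Df y' (S.Z y' p u) (S.X v - S.X u))) +
      (S.Z y' u v - S.Z A u v) -
      (S.f A - S.f y - S.Df y (A - y)) (S.X v - S.X u) +
      (S.Df y' - S.Df y) (S.f y' (S.X u - S.X p) + S.Z y' p u) (S.X v - S.X u) +
      S.Df y ((S.f y' - S.f y) (S.X u - S.X p)) (S.X v - S.X u) := by
    have e : A - y = S.f y (S.X u - S.X p) + S.Z y' p u := by rw [hA]; abel
    rw [e]
    simp only [map_add, map_sub, sub_apply, add_apply]
    abel
  rw [key]
  refine (norm_add_le_of_le (norm_add_le_of_le (norm_sub_le_of_le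
    (norm_add_le_of_le e1 e2) e3) e4) e5).trans ?_
  have k1 : K ≤ K ^ 6 := le_self_pow₀ hK1 (by norm_num)
  have k3 : K ^ 3 ≤ K ^ 6 := pow_le_pow_right₀ hK1 (by norm_num)
  have f1 : K * H ^ 3 ≤ K ^ 6 * G := by gcongr
  have f3 : 3 * K ^ 3 * G ≤ 3 * K ^ 6 * G := by gcongr
  have f4 : 0 ≤ K ^ 6 * G := by positivity
  linarith

/-- The single-speed interpolation of a splitting scheme: on a grid cell starting at `p`, both
split equations are evaluated at the same time. -/
def interp (S : RoughSetting d) (h : ℝ) (Y : ℝ → EuclideanSpace ℝ (Fin d)) (u : ℝ) :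
    EuclideanSpace ℝ (Fin d) :=
  Y (⌊u / h⌋₊ * h) + S.f (Y (⌊u / h⌋₊ * h)) (S.X u - S.X (⌊u / h⌋₊ * h)) +
    S.Z (Y (⌊u / h⌋₊ * h + h / 2)) (⌊u / h⌋₊ * h) u

/-- The difference of the single-speed interpolations of two splitting schemes. -/
def interpDiff (S : RoughSetting d) (h h' : ℝ) (Y Y' : ℝ → EuclideanSpace ℝ (Fin d)) (u : ℝ) :
    EuclideanSpace ℝ (Fin d) :=
  S.interp h Y u - S.interp h' Y' u

variable {Ybar : EuclideanSpace ℝ (Fin d)} {Y : ℝ → EuclideanSpace ℝ (Fin d)}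

lemma interp_natCast_mul (hh : 0 < h) (Y : ℝ → EuclideanSpace ℝ (Fin d)) (j : ℕ) :
    S.interp h Y (j * h) = Y (j * h) := by
  simp [interp, hh.ne', S.hZ_diag]

lemma IsScheme.half_step (hY : S.IsScheme h Ybar Y) (hh : 0 < h) (j : ℕ) :
    Y (j * h + h / 2) = Y (j * h) + S.f (Y (j * h)) (S.X (j * h + h) - S.X (j * h)) := by
  rw [((hY.2 j (j * h + h / 2)).1 ⟨by linarith, le_rfl⟩)]
  ring_nf

lemma IsScheme.interp_eq (hY : S.IsScheme h Ybar Y) (hh : 0 < h) (j : ℕ) {v : ℝ}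
    (h1 : j * h ≤ v) (h2 : v ≤ j * h + h) :
    S.interp h Y v = Y (j * h) + S.f (Y (j * h)) (S.X v - S.X (j * h)) +
      S.Z (Y (j * h + h / 2)) (j * h) v := by
  rcases h2.lt_or_eq with h2 | rfl
  · have : ⌊v / h⌋₊ = j := by
      rw [Nat.floor_eq_iff (div_nonneg (le_trans (by positivity) h1) hh.le), le_div_iff₀ hh,
        div_lt_iff₀ hh]
      exact ⟨h1, by linarith⟩
    rw [interp, this]
  · have e : (j : ℝ) * h + h = ((j + 1 : ℕ) : ℝ) * h := by push_cast; ring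
    have e2 : (j : ℝ) * h + 2 * (j * h + h - (j * h + h / 2)) = j * h + h := by ring
    rw [e, interp_natCast_mul hh, ← e, ← hY.half_step hh,
      ((hY.2 j (j * h + h)).2 ⟨by linarith, le_rfl⟩), e2]

lemma IsScheme.norm_sub_interp_le_of_left (hY : S.IsScheme h Ybar Y) (hh : 0 < h)
    (hK : S.IsBound K) (hH : h ^ S.α ≤ H) (j : ℕ) {v : ℝ} (h1 : j * h < v)
    (h2 : v ≤ j * h + h) :
    ‖Y ((j * h + v) / 2) - S.interp h Y v‖ ≤ 2 * K * H ^ 2 := by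
  have hZ := hK.norm_Z_le hH (Y (j * h + h / 2)) h1.le (by linarith)
  have e : (j : ℝ) * h + 2 * ((j * h + v) / 2 - j * h) = v := by ring
  rw [hY.interp_eq hh j h1.le h2,
    ((hY.2 j ((j * h + v) / 2)).1 ⟨by linarith, by linarith⟩), e, sub_add_cancel_left, norm_neg]
  have := norm_nonneg (S.Z (Y (j * h + h / 2)) (j * h) v)
  linarith

lemma IsScheme.norm_sub_interp_le_of_right (hY : S.IsScheme h Ybar Y) (hh : 0 < h)
    (hK : S.IsBound K) (hH : h ^ S.α ≤ H) (j : ℕ) {u : ℝ} (h1 : j * h ≤ u)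
    (h2 : u < j * h + h) :
    ‖Y ((u + (j * h + h)) / 2) - S.interp h Y (j * h + h)‖ ≤ 2 * K * H ^ 2 := by
  have hZ := hK.norm_Z_le hH (Y (j * h + h / 2)) (by linarith : j * h ≤ j * h + h) (by linarith)
  have hZ' := hK.norm_Z_le hH (Y (j * h + h / 2)) h1 (by linarith)
  have hm : Y ((u + (j * h + h)) / 2) =
      Y (j * h + h / 2) + S.Z (Y (j * h + h / 2)) (j * h) u := by
    rcases h1.eq_or_lt with rfl | h1
    · rw [S.hZ_diag, add_zero]
      ring_nf
    · rw [((hY.2 j ((u + (j * h + h)) / 2)).2 ⟨by linarith, by linarith⟩)]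
      ring_nf
  rw [hY.interp_eq hh j (by linarith) le_rfl, hm, ← hY.half_step hh, add_sub_add_left_eq_sub]
  exact (norm_sub_le_of_le hZ' hZ).trans (by linarith)

section Increments

variable {j : ℕ} {u v : ℝ}

lemma IsScheme.interp_sub (hY : S.IsScheme h Ybar Y) (hh : 0 < h) (h1 : j * h ≤ u)
    (h2 : u ≤ v) (h3 : v ≤ j * h + h) :
    S.interp h Y v - S.interp h Y u = S.f (Y (j * h)) (S.X v - S.X u) +
      S.Z (Y (j * h + h / 2)) (j * h) v - S.Z (Y (j * h + h / 2)) (j * h) u := by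
  rw [hY.interp_eq hh j (h1.trans h2) h3, hY.interp_eq hh j h1 (h2.trans h3)]
  simp only [map_sub]
  abel

lemma IsScheme.norm_interp_sub_le (hY : S.IsScheme h Ybar Y) (hh : 0 < h)
    (hK : S.IsBound K) (hH : h ^ S.α ≤ H) (h1 : j * h ≤ u) (h2 : u ≤ v)
    (h3 : v ≤ j * h + h) :
    ‖S.interp h Y v - S.interp h Y u‖ ≤ K ^ 2 * H + 2 * K * H ^ 2 := by
  rw [hY.interp_sub hh h1 h2 h3]
  have hX := hK.norm_f_apply_le (Y (j * h)) (hK.norm_X_sub_le hH h2 (by linarith))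
  have hZ := hK.norm_Z_le hH (Y (j * h + h / 2)) (h1.trans h2) (by linarith)
  have hZ' := hK.norm_Z_le hH (Y (j * h + h / 2)) h1 (by linarith)
  exact (norm_sub_le_of_le (norm_add_le_of_le hX hZ) hZ').trans (by linarith)

lemma IsScheme.norm_interp_sub_expansion_le (hY : S.IsScheme h Ybar Y) (hh : 0 < h)
    (hK : S.IsBound K) (hH : h ^ S.α ≤ H) (hH0 : 0 < H) (hH1 : H ≤ 1) (h1 : j * h ≤ u)
    (h2 : u ≤ v) (h3 : v ≤ j * h + h) :
    ‖S.interp h Y v - S.interp h Y u -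
        (S.f (S.interp h Y u) (S.X v - S.X u) + S.Z (S.interp h Y u) u v)‖ ≤
      14 * K ^ 6 * H ^ S.γ := by
  rw [hY.interp_sub hh h1 h2 h3]
  refine hK.norm_local_expansion_le hH hH0 hH1 _ _ h1 h2 (by linarith) ?_ _
    (hY.interp_eq hh j h1 (h2.trans h3))
  rw [hY.half_step hh, add_sub_cancel_left]
  refine (hK.norm_f_apply_le _ (hK.norm_X_sub_le hH (by linarith) (by linarith))).trans ?_
  exact le_of_eq (by ring)

end Increments

section Pair

variable {h' : ℝ} {Ybar' : EuclideanSpace ℝ (Fin d)} {Y' : ℝ → EuclideanSpace ℝ (Fin d)}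
  {i j : ℕ} {u v : ℝ}

/-- The interval `[u, v]` lies in the `j`-th cell of the grid of step `h` and in the `i`-th cell
of the grid of step `h'`. -/
structure InCells (h h' : ℝ) (j i : ℕ) (u v : ℝ) : Prop where
  lt : u < v
  left : j * h ≤ u
  right : v ≤ j * h + h
  left' : i * h' ≤ u
  right' : v ≤ i * h' + h'

lemma norm_interpDiff_sub_le (hY : S.IsScheme h Ybar Y) (hY' : S.IsScheme h' Ybar' Y')
    (hh : 0 < h) (hh' : 0 < h') (hK : S.IsBound K) (hH : h ^ S.α ≤ H) (hH' : h' ^ S.α ≤ H)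
    (hc : InCells h h' j i u v) :
    ‖S.interpDiff h h' Y Y' v - S.interpDiff h h' Y Y' u‖ ≤ 2 * K ^ 2 * H + 4 * K * H ^ 2 := by
  have e1 := hY.norm_interp_sub_le hh hK hH hc.left hc.lt.le hc.right
  have e2 := hY'.norm_interp_sub_le hh' hK hH' hc.left' hc.lt.le hc.right'
  rw [interpDiff, interpDiff, sub_sub_sub_comm]
  exact (norm_sub_le_of_le e1 e2).trans (by linarith)

lemma norm_interpDiff_sub_expansion_le (hY : S.IsScheme h Ybar Y)
    (hY' : S.IsScheme h' Ybar' Y') (hh : 0 < h) (hh' : 0 < h') (hK : S.IsBound K)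
    (hH : h ^ S.α ≤ H) (hH' : h' ^ S.α ≤ H) (hH0 : 0 < H) (hH1 : H ≤ 1)
    (hc : InCells h h' j i u v) :
    ‖S.interpDiff h h' Y Y' v - S.interpDiff h h' Y Y' u -
        ((S.f (S.interp h Y u) - S.f (S.interp h' Y' u)) (S.X v - S.X u) +
          (S.Z (S.interp h Y u) u v - S.Z (S.interp h' Y' u) u v))‖ ≤
      28 * K ^ 6 * H ^ S.γ := by
  have e1 := hY.norm_interp_sub_expansion_le hh hK hH hH0 hH1 hc.left hc.lt.le hc.right
  have e2 := hY'.norm_interp_sub_expansion_le hh' hK hH' hH0 hH1 hc.left' hc.lt.le hc.right'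
  refine le_trans (le_of_eq ?_) ((norm_sub_le_of_le e1 e2).trans (by linarith))
  rw [interpDiff, interpDiff]
  simp only [sub_apply]
  congr 1
  abel

lemma norm_interpDiff_sub_le_rpow (hY : S.IsScheme h Ybar Y)
    (hY' : S.IsScheme h' Ybar' Y') (hh : 0 < h) (hh' : 0 < h') (hK : S.IsBound K)
    (hH : h ^ S.α ≤ H) (hH' : h' ^ S.α ≤ H) (hH0 : 0 < H) (hH1 : H ≤ 1)
    (hc : InCells h h' j i u v) :
    ‖S.interpDiff h h' Y Y' v - S.interpDiff h h' Y Y' u‖ ≤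
      28 * K ^ 6 * (H ^ S.γ + ‖S.interpDiff h h' Y Y' u‖ ^ (S.γ - 2) * H ^ 2 +
        ‖S.interpDiff h h' Y Y' u‖ * H) := by
  have e := norm_interpDiff_sub_expansion_le hY hY' hh hh' hK hH hH' hH0 hH1 hc
  have hvu : v - u ≤ h := by linarith [hc.left, hc.right]
  have e1 := ContinuousLinearMap.le_of_opNorm_le_of_le _
    (hK.norm_f_sub_le (S.interp h Y u) (S.interp h' Y' u)) (hK.norm_X_sub_le hH hc.lt.le hvu)
  have e2 := hK.norm_Z_sub_le hH (S.interp h Y u) (S.interp h' Y' u) hc.lt.le hvu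
  have e3 := norm_add_le_of_le e (norm_add_le_of_le e1 e2)
  rw [sub_add_cancel] at e3
  refine e3.trans ?_
  have hK1 := hK.one_le
  rw [← interpDiff]
  set x := ‖S.interpDiff h h' Y Y' u‖
  have hx : 0 ≤ x := norm_nonneg _
  have k1 : K ≤ K ^ 6 := le_self_pow₀ hK1 (by norm_num)
  have k2 : K ^ 2 ≤ K ^ 6 := pow_le_pow_right₀ hK1 (by norm_num)
  have f1 : K ^ 2 * (x * H) ≤ K ^ 6 * (x * H) := by gcongr
  have f2 : K * (x ^ (S.γ - 2) * H ^ 2) ≤ K ^ 6 * (x ^ (S.γ - 2) * H ^ 2) := by gcongr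
  have f3 : 0 ≤ K ^ 6 * (x * H) := by positivity
  have f4 : 0 ≤ K ^ 6 * (x ^ (S.γ - 2) * H ^ 2) := by positivity
  nlinarith

/-- Up to second order, only the first-order term driven by `X` contributes. -/
lemma norm_interpDiff_sub_first_order_le (hY : S.IsScheme h Ybar Y)
    (hY' : S.IsScheme h' Ybar' Y') (hh : 0 < h) (hh' : 0 < h') (hK : S.IsBound K)
    (hH : h ^ S.α ≤ H) (hH' : h' ^ S.α ≤ H) (hH0 : 0 < H) (hH1 : H ≤ 1)
    (hc : InCells h h' j i u v) :
    ‖S.interpDiff h h' Y Y' v - S.interpDiff h h' Y Y' u -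
        (S.f (S.interp h Y u) - S.f (S.interp h' Y' u)) (S.X v - S.X u)‖ ≤
      30 * K ^ 6 * H ^ 2 := by
  have e := norm_interpDiff_sub_expansion_le hY hY' hh hh' hK hH hH' hH0 hH1 hc
  have hvu : v - u ≤ h := by linarith [hc.left, hc.right]
  have e3 := norm_add_le_of_le e (norm_sub_le_of_le
    (hK.norm_Z_le hH (S.interp h Y u) hc.lt.le hvu)
    (hK.norm_Z_le hH (S.interp h' Y' u) hc.lt.le hvu))
  rw [← sub_sub, sub_add_cancel] at e3
  refine e3.trans ?_
  have hK1 := hK.one_le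
  have k1 : K ≤ K ^ 6 := le_self_pow₀ hK1 (by norm_num)
  have g : H ^ S.γ ≤ H ^ 2 := by
    rw [← Real.rpow_natCast H 2]
    exact Real.rpow_le_rpow_of_exponent_ge hH0 hH1 (by simpa using S.two_lt_gamma.le)
  have f1 : K * H ^ 2 ≤ K ^ 6 * H ^ 2 := by gcongr
  have f2 : K ^ 6 * H ^ S.γ ≤ K ^ 6 * H ^ 2 := by gcongr
  linarith

lemma norm_interpDiff_right_le (hY : S.IsScheme h Ybar Y)
    (hY' : S.IsScheme h' Ybar' Y') (hh : 0 < h) (hh' : 0 < h') (hK : S.IsBound K)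
    (hH : h ^ S.α ≤ H) (hH' : h' ^ S.α ≤ H) (hH0 : 0 < H) (hH1 : H ≤ 1)
    (hc : InCells h h' j i u v) :
    ‖S.interpDiff h h' Y Y' v‖ ≤
      64 * K ^ 8 * (‖S.interpDiff h h' Y Y' u‖ + H ^ 2) := by
  have e := norm_interpDiff_sub_first_order_le hY hY' hh hh' hK hH hH' hH0 hH1 hc
  have hvu : v - u ≤ h := by linarith [hc.left, hc.right]
  have e1 := ContinuousLinearMap.le_of_opNorm_le_of_le _
    (hK.norm_f_sub_le (S.interp h Y u) (S.interp h' Y' u)) (hK.norm_X_sub_le hH hc.lt.le hvu)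
  have e3 := norm_add_le_of_le (norm_add_le_of_le e e1) (le_refl ‖S.interpDiff h h' Y Y' u‖)
  rw [sub_add_cancel, sub_add_cancel, ← interpDiff] at e3
  refine e3.trans ?_
  have hK1 := hK.one_le
  set x := ‖S.interpDiff h h' Y Y' u‖
  have hx : 0 ≤ x := norm_nonneg _
  have k1 : K ^ 6 * H ^ 2 ≤ K ^ 8 * H ^ 2 := by gcongr; norm_num
  have k2 : K ^ 2 * x * H ≤ K ^ 8 * x * 1 := by gcongr; norm_num
  have k3 : 1 * x ≤ K ^ 8 * x := by gcongr; exact one_le_pow₀ hK1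
  have k4 : 0 ≤ K ^ 8 * H ^ 2 := by positivity
  nlinarith

lemma norm_interpDiff_left_le (hY : S.IsScheme h Ybar Y)
    (hY' : S.IsScheme h' Ybar' Y') (hh : 0 < h) (hh' : 0 < h') (hK : S.IsBound K)
    (hH : h ^ S.α ≤ H) (hH' : h' ^ S.α ≤ H) (hH0 : 0 < H) (hH1 : H ≤ 1)
    (hc : InCells h h' j i u v) :
    ‖S.interpDiff h h' Y Y' u‖ ≤
      64 * K ^ 8 * (‖S.interpDiff h h' Y Y' v‖ + H ^ 2) := by
  have e := norm_interpDiff_sub_first_order_le hY hY' hh hh' hK hH hH' hH0 hH1 hc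
  have hvu : v - u ≤ h := by linarith [hc.left, hc.right]
  have hX := hK.norm_X_sub_le hH hc.lt.le hvu
  have e1 := ContinuousLinearMap.le_of_opNorm_le_of_le _
    (hK.norm_f_sub_le (S.interp h Y u) (S.interp h' Y' u)) hX
  have e2 := ContinuousLinearMap.le_of_opNorm_le_of_le _
    (norm_sub_le_of_le (hK.norm_f_le (S.interp h Y u)) (hK.norm_f_le (S.interp h' Y' u))) hX
  have aux : ∀ b : ℝ,
      ‖(S.f (S.interp h Y u) - S.f (S.interp h' Y' u)) (S.X v - S.X u)‖ ≤ b →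
      ‖S.interpDiff h h' Y Y' u‖ ≤ ‖S.interpDiff h h' Y Y' v‖ + (30 * K ^ 6 * H ^ 2 + b) := by
    intro b hb
    have := norm_sub_le_of_le (le_refl ‖S.interpDiff h h' Y Y' v‖) (norm_add_le_of_le e hb)
    rwa [sub_add_cancel, sub_sub_cancel] at this
  have a1 := aux _ e1
  have a2 := aux _ e2
  have hK1 := hK.one_le
  rw [← interpDiff] at a1
  set x := ‖S.interpDiff h h' Y Y' u‖
  set w := ‖S.interpDiff h h' Y Y' v‖
  have hw : 0 ≤ w := norm_nonneg _
  have a3 : K ^ 2 * x * H ≤ K ^ 2 * (w + (30 * K ^ 6 * H ^ 2 + (K + K) * (K * H))) * H := by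
    gcongr
  have k0 : K ^ 6 * H ^ 2 ≤ K ^ 8 * H ^ 2 := by gcongr; norm_num
  have k1 : K ^ 2 * w * H ≤ K ^ 8 * w * 1 := by gcongr; norm_num
  have k2 : K ^ 8 * H ^ 2 * H ≤ K ^ 8 * H ^ 2 * 1 := by gcongr
  have k3 : 1 * w ≤ K ^ 8 * w := by gcongr; exact one_le_pow₀ hK1
  have k4 : K ^ 4 * H ^ 2 ≤ K ^ 8 * H ^ 2 := by gcongr; norm_num
  have k5 : 0 ≤ K ^ 8 * w := by positivity
  nlinarith

lemma norm_interpDiff_le_of_alternating (hY : S.IsScheme h Ybar Y)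
    (hY' : S.IsScheme h' Ybar' Y') (hh : 0 < h) (hh' : 0 < h') (hK : S.IsBound K)
    (hH : h ^ S.α ≤ H) (hH' : h' ^ S.α ≤ H)
    (hc : InCells h h' j i u v)
    (halt : (u = j * h ∧ v = i * h' + h') ∨ (u = i * h' ∧ v = j * h + h)) :
    ‖S.interpDiff h h' Y Y' v‖ ≤ ‖Y ((u + v) / 2) - Y' ((u + v) / 2)‖ + 4 * K * H ^ 2 := by
  have key : ‖Y ((u + v) / 2) - S.interp h Y v‖ ≤ 2 * K * H ^ 2 ∧
      ‖Y' ((u + v) / 2) - S.interp h' Y' v‖ ≤ 2 * K * H ^ 2 := by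
    obtain ⟨hlt, h1, h2, h3, h4⟩ := hc
    rcases halt with ⟨hu, hv⟩ | ⟨hu, hv⟩
    · constructor
      · have := hY.norm_sub_interp_le_of_left hh hK hH j (hu ▸ hlt) h2
        rwa [← hu] at this
      · have := hY'.norm_sub_interp_le_of_right hh' hK hH' i h3 (hv ▸ hlt)
        rwa [← hv] at this
    · constructor
      · have := hY.norm_sub_interp_le_of_right hh hK hH j h1 (hv ▸ hlt)
        rwa [← hv] at this
      · have := hY'.norm_sub_interp_le_of_left hh' hK hH' i (hu ▸ hlt) h4
        rwa [← hu] at this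
  have := norm_sub_le_of_le (le_refl ‖Y ((u + v) / 2) - Y' ((u + v) / 2)‖)
    (norm_sub_le_of_le key.1 key.2)
  rw [interpDiff]
  refine le_trans (le_of_eq ?_) (this.trans (by linarith))
  congr 1
  abel

end Pair

section Chain

variable {h' : ℝ} {Ybar' : EuclideanSpace ℝ (Fin d)} {Y' : ℝ → EuclideanSpace ℝ (Fin d)}

lemma le_pow_mul_of_chain {e : ℕ → ℝ} {P : ℕ → Prop} {B W s : ℝ} {N : ℕ} (hN : 1 ≤ N)
    (hB : 1 ≤ B) (hW : 0 ≤ W) (hs : 0 ≤ s) (hP : P 1) (hleft : e 0 ≤ B * (e 1 + W))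
    (hright : ∀ l < N, e (l + 1) ≤ B * (e l + W))
    (hbd : ∀ l < N, P (l + 1) → e (l + 1) ≤ B * (s + W)) {l : ℕ} (hl : l ≤ N) :
    e l ≤ (2 * B ^ 2) ^ (l + 1) * (s + W) := by
  induction l with
  | zero =>
    have h1 := hbd 0 hN hP
    have : B * (e 1 + W) ≤ B * (B * (s + W) + B * (s + W)) := by
      gcongr
      nlinarith
    calc e 0 ≤ _ := hleft.trans this
      _ = _ := by ring
  | succ l ih =>
    have ih := ih (by omega)
    set R := (2 * B ^ 2) ^ (l + 1) with hR
    have hB2 : 1 ≤ 2 * B ^ 2 := by nlinarith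
    have hR1 : 1 ≤ R := one_le_pow₀ hB2
    calc e (l + 1) ≤ B * (e l + W) := hright l hl
      _ ≤ B * (R * (s + W) + R * (s + W)) := by
          gcongr
          nlinarith
      _ = 2 * B * 1 * (R * (s + W)) := by ring
      _ ≤ 2 * B * B * (R * (s + W)) := by gcongr
      _ = (2 * B ^ 2) ^ (l + 1 + 1) * (s + W) := by rw [pow_succ _ (l + 1), ← hR]; ring

/-- The constant in `norm_interpDiff_chain_le`. -/
def chainConst (K : ℝ) (N : ℕ) : ℝ :=
  N * (28 * K ^ 6 * (1 + 6 * N * K ^ 2 + (2 * (64 * K ^ 8) ^ 2) ^ (N + 1)))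

/-- The key estimate along a chain of times `τ 0 < ⋯ < τ N`, each consecutive pair of which lies
in a cell of either grid; `P` marks the indices whose pair is alternating between the grids. -/
theorem norm_interpDiff_chain_le (hY : S.IsScheme h Ybar Y) (hY' : S.IsScheme h' Ybar' Y')
    (hh : 0 < h) (hh' : 0 < h') (hK : S.IsBound K) (hH : h ^ S.α ≤ H) (hH' : h' ^ S.α ≤ H)
    (hH0 : 0 < H) {N : ℕ} (hN : 1 ≤ N) {τ : ℕ → ℝ} {P : ℕ → Prop} (hP : P 1)
    (hτ : ∀ l < N, ∃ j i : ℕ, InCells h h' j i (τ l) (τ (l + 1)) ∧ (P (l + 1) →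
      (τ l = j * h ∧ τ (l + 1) = i * h' + h') ∨ (τ l = i * h' ∧ τ (l + 1) = j * h + h)))
    {s : ℝ} (hs : ∀ l < N, P (l + 1) →
      ‖Y ((τ l + τ (l + 1)) / 2) - Y' ((τ l + τ (l + 1)) / 2)‖ ≤ s) :
    ‖S.interpDiff h h' Y Y' (τ N) - S.interpDiff h h' Y Y' (τ 0)‖ ≤
      chainConst K N * (H ^ S.γ + ‖S.interpDiff h h' Y Y' (τ 0)‖ ^ (S.γ - 2) * H ^ 2 + s * H) := by
  have hK1 := hK.one_le
  have hs0 : 0 ≤ s := (norm_nonneg _).trans (hs 0 hN hP)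
  have hδ := S.two_lt_gamma
  have hδ' := S.hγ₂
  set D : ℕ → EuclideanSpace ℝ (Fin d) := fun l => S.interpDiff h h' Y Y' (τ l) with hD
  change ‖D N - D 0‖ ≤ chainConst K N * (H ^ S.γ + ‖D 0‖ ^ (S.γ - 2) * H ^ 2 + s * H)
  have hcrude : ∀ l < N, ‖D (l + 1) - D l‖ ≤ 2 * K ^ 2 * H + 4 * K * H ^ 2 := fun l hl => by
    obtain ⟨j, i, hc, -⟩ := hτ l hl
    exact norm_interpDiff_sub_le hY hY' hh hh' hK hH hH' hc
  have hsum : ∀ n, ‖D n - D 0‖ ≤ ∑ l ∈ Finset.range n, ‖D (l + 1) - D l‖ := fun n => by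
    rw [← Finset.sum_range_sub]
    exact norm_sum_le _ _
  set G := H ^ S.γ with hG
  set L := H ^ (S.γ - 2) with hL
  have hGL : G = L * H ^ 2 := S.rpow_gamma_eq hH0
  have hG0 : 0 ≤ G := Real.rpow_nonneg hH0.le _
  have hL0 : 0 ≤ L := Real.rpow_nonneg hH0.le _
  set x := ‖D 0‖ ^ (S.γ - 2) with hx
  have hx0 : 0 ≤ x := Real.rpow_nonneg (norm_nonneg _) _
  set Q := (2 * (64 * K ^ 8) ^ 2) ^ (N + 1) with hQ
  have hQ0 : 0 ≤ Q := by positivity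
  have hN1 : (1 : ℝ) ≤ N := by exact_mod_cast hN
  have hKK : 1 ≤ K ^ 2 := one_le_pow₀ hK1
  have hxH : 0 ≤ x * H ^ 2 := by positivity
  have hsH : 0 ≤ s * H := by positivity
  set R := 1 + 6 * N * K ^ 2 + Q with hR
  have hR1 : 1 ≤ 6 * N * K ^ 2 := by nlinarith
  have hstep : ∀ l < N, ‖D (l + 1) - D l‖ ≤ 28 * K ^ 6 * R * (G + x * H ^ 2 + s * H) := by
    intro l hl
    rcases le_total H 1 with hH1 | hH1
    · have hB : (1 : ℝ) ≤ 64 * K ^ 8 := by nlinarith [one_le_pow₀ hK1 (n := 8)]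
      have hKB : 4 * K ≤ 64 * K ^ 8 := by nlinarith [le_self_pow₀ hK1 (n := 8) (by norm_num)]
      have hchain : ‖D l‖ ≤ Q * (s + H ^ 2) := by
        refine (le_pow_mul_of_chain (e := fun l => ‖D l‖) (P := P) hN hB (sq_nonneg H) hs0 hP ?_
          (fun l hl => ?_) (fun l hl hPl => ?_) hl.le).trans ?_
        · obtain ⟨j, i, hc, -⟩ := hτ 0 hN
          exact norm_interpDiff_left_le hY hY' hh hh' hK hH hH' hH0 hH1 hc
        · obtain ⟨j, i, hc, -⟩ := hτ l hl
          exact norm_interpDiff_right_le hY hY' hh hh' hK hH hH' hH0 hH1 hc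
        · obtain ⟨j, i, hc, halt⟩ := hτ l hl
          refine (norm_interpDiff_le_of_alternating hY hY' hh hh' hK hH hH' hc (halt hPl)).trans ?_
          have f1 : 4 * K * H ^ 2 ≤ 64 * K ^ 8 * H ^ 2 := by gcongr
          have f2 : 1 * s ≤ 64 * K ^ 8 * s := by gcongr
          have := hs l hl hPl
          linarith
        · have : 1 ≤ 2 * (64 * K ^ 8) ^ 2 := by nlinarith
          gcongr
          exact pow_le_pow_right₀ this (by omega)
      have hgrowth : ‖D l‖ ≤ ‖D 0‖ + 6 * N * K ^ 2 * H := by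
        have h1 : ‖D l - D 0‖ ≤ 6 * N * K ^ 2 * H := by
          refine (hsum l).trans ((Finset.sum_le_card_nsmul _ _ (6 * K ^ 2 * H)
            fun i hi => (hcrude i ((Finset.mem_range.1 hi).trans hl)).trans ?_).trans ?_)
          · have f1 : K * H ^ 2 ≤ K ^ 2 * H := by
              have : K * H ≤ K ^ 2 := by nlinarith
              calc K * H ^ 2 = (K * H) * H := by ring
                _ ≤ K ^ 2 * H := by gcongr
            linarith
          · rw [Finset.card_range, nsmul_eq_mul]
            have : (l : ℝ) ≤ N := by exact_mod_cast hl.le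
            calc (l : ℝ) * (6 * K ^ 2 * H) ≤ N * (6 * K ^ 2 * H) := by gcongr
              _ = _ := by ring
        have h2 := norm_add_le_of_le h1 (le_refl ‖D 0‖)
        rw [sub_add_cancel] at h2
        linarith
      have hpow : ‖D l‖ ^ (S.γ - 2) ≤ x + 6 * N * K ^ 2 * L := by
        refine (Real.rpow_le_rpow (norm_nonneg _) hgrowth (by linarith)).trans ?_
        refine (Real.rpow_add_le_add_rpow (norm_nonneg _) (by positivity) (by linarith)
          (by linarith)).trans ?_
        gcongr
        exact rpow_gamma_sub_two_le (by positivity) hR1 hH0 le_rfl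
      have hcube : H ^ 3 ≤ G := S.cube_le_rpow_gamma hH0 hH1
      obtain ⟨j, i, hc, -⟩ := hτ l hl
      refine (norm_interpDiff_sub_le_rpow hY hY' hh hh' hK hH hH' hH0 hH1 hc).trans ?_
      rw [mul_assoc (28 * K ^ 6)]
      refine mul_le_mul_of_nonneg_left ?_ (by positivity)
      calc G + ‖D l‖ ^ (S.γ - 2) * H ^ 2 + ‖D l‖ * H
          ≤ G + (x + 6 * N * K ^ 2 * L) * H ^ 2 + Q * (s + H ^ 2) * H := by gcongr
        _ = G + x * H ^ 2 + 6 * N * K ^ 2 * G + Q * (s * H) + Q * H ^ 3 := by rw [hGL]; ring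
        _ ≤ G + x * H ^ 2 + 6 * N * K ^ 2 * G + Q * (s * H) + Q * G := by gcongr
        _ ≤ R * (G + x * H ^ 2 + s * H) := by
          rw [hR]
          nlinarith [mul_nonneg hQ0 hxH, mul_nonneg (zero_le_one.trans hR1) hxH,
            mul_nonneg (zero_le_one.trans hR1) hsH]
    · refine (hcrude l hl).trans ?_
      have g : H ^ 2 ≤ G := by
        rw [hG, ← Real.rpow_natCast H 2]
        exact Real.rpow_le_rpow_of_exponent_le hH1 (by simpa using hδ.le)
      have g1 : H ≤ G := (le_self_pow₀ hH1 (by norm_num)).trans g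
      have k1 : K ≤ K ^ 6 := le_self_pow₀ hK1 (by norm_num)
      have k2 : K ^ 2 ≤ K ^ 6 := pow_le_pow_right₀ hK1 (by norm_num)
      have f1 : K ^ 2 * H ≤ K ^ 6 * G := by gcongr
      have f2 : K * H ^ 2 ≤ K ^ 6 * G := by gcongr
      have f3 : 0 ≤ K ^ 6 * G := by positivity
      have f4 : 28 * K ^ 6 * 1 * G ≤ 28 * K ^ 6 * R * (G + x * H ^ 2 + s * H) := by
        gcongr <;> linarith
      linarith
  refine (hsum N).trans ((Finset.sum_le_card_nsmul _ _ _
    fun i hi => hstep i (Finset.mem_range.1 hi)).trans (le_of_eq ?_))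
  rw [Finset.card_range, nsmul_eq_mul, chainConst]
  ring

end Chain

end RoughSetting

lemma exists_nat_cell {h u : ℝ} (hh : 0 < h) (hu : 0 ≤ u) :
    ∃ j : ℕ, j * h ≤ u ∧ u < j * h + h := by
  refine ⟨⌊u / h⌋₊, ?_, ?_⟩
  · exact (le_div_iff₀ hh).1 (Nat.floor_le (div_nonneg hu hh.le))
  · have := (div_lt_iff₀ hh).1 (Nat.lt_floor_add_one (u / h))
    linarith

lemma mem_gridTs {k n : ℕ} {hq x : ℝ} :
    x ∈ gridTs k n hq ↔ ∃ i : ℕ, n * k < i ∧ i < (n + 1) * k ∧ (i : ℝ) * hq = x := by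
  simp only [gridTs, Finset.mem_image, Finset.mem_Icc]
  constructor
  · rintro ⟨j, hj, rfl⟩
    exact ⟨n * k + j, by omega, by rw [Nat.succ_mul]; omega, rfl⟩
  · rintro ⟨i, h1, h2, rfl⟩
    rw [Nat.succ_mul] at h2
    exact ⟨i - n * k, by omega, by rw [Nat.add_sub_cancel' h1.le]⟩

lemma mem_gridTt {m n : ℕ} {h x : ℝ} :
    x ∈ gridTt m n h ↔ ∃ j : ℕ, n * m < j ∧ j ≤ (n + 1) * m ∧ (j : ℝ) * h = x := by
  simp only [gridTt, Finset.mem_image, Finset.mem_Icc]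
  constructor
  · rintro ⟨j, hj, rfl⟩
    exact ⟨n * m + j, by omega, by rw [Nat.succ_mul]; omega, rfl⟩
  · rintro ⟨i, h1, h2, rfl⟩
    rw [Nat.succ_mul] at h2
    exact ⟨i - n * m, by omega, by rw [Nat.add_sub_cancel' h1.le]⟩

/-- If `u < jh + h`, then no grid point below `u` exceeds `jh`. -/
lemma natCast_mul_le_of_le {h u : ℝ} (hh : 0 < h) {i j : ℕ} (hj : u < j * h + h)
    (hi : i * h ≤ u) : (i : ℝ) * h ≤ j * h := by
  have : (i : ℝ) * h < ((j + 1 : ℕ) : ℝ) * h := by push_cast; linarith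
  have : i < j + 1 := by exact_mod_cast lt_of_mul_lt_mul_right this hh.le
  have : (i : ℝ) ≤ j := by exact_mod_cast Nat.lt_succ_iff.1 this
  gcongr

/-- If `jh ≤ u`, then every grid point above `u` is at least `jh + h`. -/
lemma natCast_mul_ge_of_lt {h u : ℝ} (hh : 0 < h) {i j : ℕ} (hj : j * h ≤ u)
    (hi : u < i * h) : (j : ℝ) * h + h ≤ i * h := by
  have : (j : ℝ) * h < i * h := by linarith
  have : j < i := by exact_mod_cast lt_of_mul_lt_mul_right this hh.le
  have : ((j + 1 : ℕ) : ℝ) ≤ i := by exact_mod_cast this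
  calc (j : ℝ) * h + h = ((j + 1 : ℕ) : ℝ) * h := by push_cast; ring
    _ ≤ i * h := by gcongr

/-- Two consecutive points of the union of both grids lie in a common cell of each grid, and they
are the opposite ends of these cells unless both are inner points of the fine grid. -/
lemma exists_inCells_of_consecutive {k m n : ℕ} {h h' u v : ℝ} (hh : 0 < h) (hh' : 0 < h')
    (hle : h' ≤ h) (hkm : (k : ℝ) * h' = m * h) (hu : u = ((n * m : ℕ) : ℝ) * h ∨
      u ∈ gridTs k n h' ∪ gridTt m n h) (hv : v ∈ gridTs k n h' ∪ gridTt m n h)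
    (huv : u < v) (hcons : ∀ x ∈ gridTs k n h' ∪ gridTt m n h, u < x → v ≤ x) :
    ∃ j i : ℕ, RoughSetting.InCells h h' j i u v ∧
      (¬(v ∈ gridTs k n h' ∧ u ∈ gridTs k n h') →
        (u = j * h ∧ v = i * h' + h') ∨ (u = i * h' ∧ v = j * h + h)) := by
  have hend : ∀ n : ℕ, ((n * k : ℕ) : ℝ) * h' = ((n * m : ℕ) : ℝ) * h := fun n => by
    push_cast
    linear_combination (n : ℝ) * hkm
  simp only [Finset.mem_union] at hu hv hcons
  have hua : ((n * m : ℕ) : ℝ) * h ≤ u := by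
    rcases hu with rfl | hu | hu
    · exact le_rfl
    · obtain ⟨i, h1, -, rfl⟩ := mem_gridTs.1 hu
      rw [← hend]
      gcongr
    · obtain ⟨i, h1, -, rfl⟩ := mem_gridTt.1 hu
      gcongr
  have hvb : v ≤ (((n + 1) * m : ℕ) : ℝ) * h := by
    rcases hv with hv | hv
    · obtain ⟨i, -, h1, rfl⟩ := mem_gridTs.1 hv
      rw [← hend]
      gcongr
    · obtain ⟨i, -, h1, rfl⟩ := mem_gridTt.1 hv
      gcongr
  have hu0 : 0 ≤ u := le_trans (by positivity) hua
  obtain ⟨j, hj, hj'⟩ := exists_nat_cell hh hu0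
  obtain ⟨i, hi, hi'⟩ := exists_nat_cell hh' hu0
  have ej : (j : ℝ) * h + h = ((j + 1 : ℕ) : ℝ) * h := by push_cast; ring
  have ei : (i : ℝ) * h' + h' = ((i + 1 : ℕ) : ℝ) * h' := by push_cast; ring
  have hvj : v ≤ j * h + h := by
    refine hcons _ (Or.inr (mem_gridTt.2 ⟨j + 1, ?_, ?_, ej.symm⟩)) hj'
    · have : ((n * m : ℕ) : ℝ) * h < ((j + 1 : ℕ) : ℝ) * h := by linarith
      exact_mod_cast lt_of_mul_lt_mul_right this hh.le
    · have : (j : ℝ) * h < (((n + 1) * m : ℕ) : ℝ) * h := by linarith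
      exact_mod_cast lt_of_mul_lt_mul_right this hh.le
  have hvi : v ≤ i * h' + h' := by
    have h1 : i < (n + 1) * k := by
      have : (i : ℝ) * h' < (((n + 1) * k : ℕ) : ℝ) * h' := by rw [hend]; linarith
      exact_mod_cast lt_of_mul_lt_mul_right this hh'.le
    have h2 : n * k < i + 1 := by
      have : ((n * k : ℕ) : ℝ) * h' < ((i + 1 : ℕ) : ℝ) * h' := by rw [hend]; linarith
      exact_mod_cast lt_of_mul_lt_mul_right this hh'.le
    rcases (Nat.succ_le_of_lt h1).lt_or_eq with h3 | h3
    · exact hcons _ (Or.inl (mem_gridTs.2 ⟨i + 1, h2, h3, ei.symm⟩)) hi'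
    · rw [ei, ← Nat.succ_eq_add_one, h3, hend]
      exact hvb
  refine ⟨j, i, ⟨huv, hj, hvj, hi, hvi⟩, fun hnot => ?_⟩
  rcases hv with hv | hv
  · left
    constructor
    · refine le_antisymm ?_ hj
      rcases hu with hu | hu | hu
      · exact hu.trans_le (natCast_mul_le_of_le hh hj' hu.ge)
      · exact absurd ⟨hv, hu⟩ hnot
      · obtain ⟨l, -, -, hl⟩ := mem_gridTt.1 hu
        exact hl.ge.trans (natCast_mul_le_of_le hh hj' hl.le)
    · obtain ⟨l, -, -, rfl⟩ := mem_gridTs.1 hv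
      exact le_antisymm hvi (natCast_mul_ge_of_lt hh' hi huv)
  · right
    have hvj' : v = j * h + h := by
      obtain ⟨l, -, -, rfl⟩ := mem_gridTt.1 hv
      exact le_antisymm hvj (natCast_mul_ge_of_lt hh hj huv)
    refine ⟨le_antisymm ?_ hi, hvj'⟩
    rcases hu with hu | hu | hu
    · rw [← hend] at hu
      exact hu.trans_le (natCast_mul_le_of_le hh' hi' hu.ge)
    · obtain ⟨l, -, -, hl⟩ := mem_gridTs.1 hu
      exact hl.ge.trans (natCast_mul_le_of_le hh' hi' hl.le)
    · obtain ⟨l, -, -, hl⟩ := mem_gridTt.1 hu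
      have := natCast_mul_le_of_le hh hj' hl.le
      linarith

/-- The key estimate for the two interleaved grids with
`q = k/m ∈ [1,2)` in lowest terms: if `τ₀ = t_{nm}` and `τ_1 < ⋯ < τ_{k+m−1}`
enumerates `𝒯 = 𝒯_s ∪ 𝒯_t` (all grid points of either grid in `(nmh, (n+1)mh]`)
in ascending order, `τ̂_ℓ = (τ_{ℓ−1} + τ_ℓ)/2`, `Λ₁ = {τ_ℓ ∈ 𝒯_s : τ_{ℓ−1} ∈ 𝒯_s}`,
and `ΔY = Y^h − Y^{h/q}`, then there is a constant `C` (depending on `k + m` but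
not on `h` or `n`) with
`|ΔY_{t_{(n+1)m}} − ΔY_{t_{nm}}| ≤ C (h^{γα} + |ΔY_{t_{nm}}|^{γ−2} h^{2α}
  + Σ_{τ_ℓ ∈ 𝒯 \ Λ₁} |ΔY_{τ̂_ℓ}| h^α)`. -/
theorem stmt10 {d : ℕ} (S : RoughSetting d) (Ybar : EuclideanSpace ℝ (Fin d))
    (k m : ℕ) (hm : 0 < m) (hq1 : m ≤ k) (hq2 : k < 2 * m) (hcop : Nat.Coprime k m) :
    ∃ C : ℝ, ∀ h : ℝ, 0 < h → ∀ n : ℕ,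
      ∀ Yh Yhq : ℝ → EuclideanSpace ℝ (Fin d),
        S.IsScheme h Ybar Yh → S.IsScheme (h * m / k) Ybar Yhq →
        ∀ τ : ℕ → ℝ,
          τ 0 = ((n * m : ℕ) : ℝ) * h →
          (∀ l : ℕ, l + 1 ≤ k + m - 1 → τ l < τ (l + 1)) →
          (Finset.Icc 1 (k + m - 1)).image τ = gridTs k n (h * m / k) ∪ gridTt m n h →
          ‖(Yh ((((n + 1) * m : ℕ) : ℝ) * h) - Yhq ((((n + 1) * m : ℕ) : ℝ) * h)) -
              (Yh (((n * m : ℕ) : ℝ) * h) - Yhq (((n * m : ℕ) : ℝ) * h))‖ ≤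
            C * (h ^ (S.γ * S.α) +
              ‖Yh (((n * m : ℕ) : ℝ) * h) - Yhq (((n * m : ℕ) : ℝ) * h)‖ ^ (S.γ - 2) *
                h ^ (2 * S.α) +
              (∑ l ∈ (Finset.Icc 1 (k + m - 1)).filter
                  (fun l => ¬(τ l ∈ gridTs k n (h * m / k) ∧
                    τ (l - 1) ∈ gridTs k n (h * m / k))),
                ‖Yh ((τ (l - 1) + τ l) / 2) - Yhq ((τ (l - 1) + τ l) / 2)‖) *
                h ^ S.α) := by
  obtain ⟨K, hK⟩ := S.exists_isBound
  refine ⟨RoughSetting.chainConst K (k + m - 1), fun h hh n Yh Yhq hY hY' τ hτ0 hmono himg => ?_⟩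
  have hk : 0 < k := hm.trans_le hq1
  have hk0 : (0 : ℝ) < k := by exact_mod_cast hk
  have hm0 : (0 : ℝ) < m := by exact_mod_cast hm
  set h' := h * m / k with hh'_def
  have hh' : 0 < h' := by positivity
  have hkm : (k : ℝ) * h' = m * h := by
    rw [hh'_def]
    field_simp
  have hle : h' ≤ h := by
    have : (m : ℝ) ≤ k := by exact_mod_cast hq1
    rw [hh'_def, div_le_iff₀ hk0]
    gcongr
  clear_value h'
  have hα : 0 < S.α := by linarith [S.hα₁]
  have hend : ∀ n : ℕ, ((n * m : ℕ) : ℝ) * h = ((n * k : ℕ) : ℝ) * h' := fun n => by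
    push_cast
    linear_combination -(n : ℝ) * hkm
  have hmem : ∀ x, x ∈ gridTs k n h' ∪ gridTt m n h ↔
      ∃ l, (1 ≤ l ∧ l ≤ k + m - 1) ∧ τ l = x := fun x => by
    rw [← himg]
    simp
  have hstrict : StrictMonoOn τ (Set.Iic (k + m - 1)) :=
    strictMonoOn_of_lt_succ Set.ordConnected_Iic fun l _ _ hl => hmono l hl
  have hτ0s : τ 0 ∉ gridTs k n h' := by
    rw [hτ0, hend, mem_gridTs]
    rintro ⟨i, h1, -, h2⟩
    have : i = n * k := by exact_mod_cast mul_right_cancel₀ hh'.ne' h2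
    omega
  have hτN : τ (k + m - 1) = (((n + 1) * m : ℕ) : ℝ) * h := by
    apply le_antisymm
    · have := (hmem _).2 ⟨k + m - 1, ⟨by omega, le_rfl⟩, rfl⟩
      rcases Finset.mem_union.1 this with hx | hx
      · obtain ⟨i, -, h1, h2⟩ := mem_gridTs.1 hx
        rw [← h2, hend]
        gcongr
      · obtain ⟨i, -, h1, h2⟩ := mem_gridTt.1 hx
        rw [← h2]
        gcongr
    · obtain ⟨l, ⟨-, h2⟩, h3⟩ := (hmem ((((n + 1) * m : ℕ) : ℝ) * h)).1
        (Finset.mem_union_right _ (mem_gridTt.2 ⟨_, by rw [Nat.succ_mul]; omega, le_rfl, rfl⟩))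
      rw [← h3]
      exact hstrict.monotoneOn h2 (Set.mem_Iic.2 le_rfl) h2
  have hcells : ∀ l < k + m - 1, ∃ j i : ℕ,
      RoughSetting.InCells h h' j i (τ l) (τ (l + 1)) ∧
      (¬(τ (l + 1) ∈ gridTs k n h' ∧ τ (l + 1 - 1) ∈ gridTs k n h') →
        (τ l = j * h ∧ τ (l + 1) = i * h' + h') ∨
          (τ l = i * h' ∧ τ (l + 1) = j * h + h)) := by
    intro l hl
    rw [Nat.add_sub_cancel]
    refine exists_inCells_of_consecutive hh hh' hle hkm ?_ ((hmem _).2 ⟨l + 1, by omega, rfl⟩)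
      (hmono l hl) fun x hx hlx => ?_
    · rcases Nat.eq_zero_or_pos l with rfl | hl0
      · exact Or.inl hτ0
      · exact Or.inr ((hmem _).2 ⟨l, by omega, rfl⟩)
    · obtain ⟨l', ⟨-, h2⟩, rfl⟩ := (hmem x).1 hx
      have h3 := (hstrict.lt_iff_lt hl.le h2).1 hlx
      exact hstrict.monotoneOn (Set.mem_Iic.2 hl) h2 h3
  have hgrid : ∀ n : ℕ, S.interpDiff h h' Yh Yhq (((n * m : ℕ) : ℝ) * h) =
      Yh (((n * m : ℕ) : ℝ) * h) - Yhq (((n * m : ℕ) : ℝ) * h) := fun n => by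
    rw [RoughSetting.interpDiff, RoughSetting.interp_natCast_mul hh, hend,
      RoughSetting.interp_natCast_mul hh']
  have hsum : ∀ l < k + m - 1,
      ¬(τ (l + 1) ∈ gridTs k n h' ∧ τ (l + 1 - 1) ∈ gridTs k n h') →
      ‖Yh ((τ l + τ (l + 1)) / 2) - Yhq ((τ l + τ (l + 1)) / 2)‖ ≤
        ∑ l ∈ (Finset.Icc 1 (k + m - 1)).filter
            (fun l => ¬(τ l ∈ gridTs k n h' ∧ τ (l - 1) ∈ gridTs k n h')),
          ‖Yh ((τ (l - 1) + τ l) / 2) - Yhq ((τ (l - 1) + τ l) / 2)‖ := by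
    intro l hl hPl
    have hmem' : l + 1 ∈ (Finset.Icc 1 (k + m - 1)).filter
        (fun l => ¬(τ l ∈ gridTs k n h' ∧ τ (l - 1) ∈ gridTs k n h')) :=
      Finset.mem_filter.2 ⟨Finset.mem_Icc.2 ⟨Nat.succ_pos l, hl⟩, hPl⟩
    have := Finset.single_le_sum
      (f := fun l => ‖Yh ((τ (l - 1) + τ l) / 2) - Yhq ((τ (l - 1) + τ l) / 2)‖)
      (fun _ _ => norm_nonneg _) hmem'
    simpa only [Nat.add_sub_cancel] using this
  generalize (∑ l ∈ (Finset.Icc 1 (k + m - 1)).filter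
    (fun l => ¬(τ l ∈ gridTs k n h' ∧ τ (l - 1) ∈ gridTs k n h')),
    ‖Yh ((τ (l - 1) + τ l) / 2) - Yhq ((τ (l - 1) + τ l) / 2)‖) = s at hsum ⊢
  have key := RoughSetting.norm_interpDiff_chain_le hY hY' hh hh' hK le_rfl
    (Real.rpow_le_rpow hh'.le hle hα.le) (Real.rpow_pos_of_pos hh _)
    (by omega : 1 ≤ k + m - 1) (τ := τ)
    (P := fun l => ¬(τ l ∈ gridTs k n h' ∧ τ (l - 1) ∈ gridTs k n h'))
    (fun hx => hτ0s hx.2) hcells hsum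
  rw [hτN, hτ0, hgrid, hgrid, ← Real.rpow_mul hh.le, ← Real.rpow_natCast, ← Real.rpow_mul hh.le,
    mul_comm S.α, mul_comm S.α] at key
  exact_mod_cast key
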